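/- arXiv:1112.0061 — 2 statements merged into one kernel-verified Lean document; each statement's English description precedes it below -/
import Mathlib

section
/- (Entropy region of 2 Gaussian random variables) For real numbers g₁, g₂, g₁₂, the following are equivalent: (i) g₁₂ ≤ g₁ + g₂; (ii) there exists a symmetric positive definite matrix R ∈ ℝ^(2×2) with log R₁₁ = g₁, log R₂₂ = g₂, and log det R = g₁₂. -/
open Matrix

/-- Entropy region of 2 jointly Gaussian random variables: `g₁₂ ≤ g₁ + g₂` is necessary and
sufficient for `(g₁, g₂, g₁₂)` to arise from a symmetric positive definite 2×2 covariance
matrix via `g₁ = log R₁₁`, `g₂ = log R₂₂`, `g₁₂ = log det R`. -/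
theorem stmt_4 (g₁ g₂ g₁₂ : ℝ) :
    g₁₂ ≤ g₁ + g₂ ↔
      ∃ R : Matrix (Fin 2) (Fin 2) ℝ, R.IsSymm ∧ R.PosDef ∧
        Real.log (R 0 0) = g₁ ∧ Real.log (R 1 1) = g₂ ∧ Real.log R.det = g₁₂ := by
  constructor
  · intro h
    have hle : Real.exp g₁₂ ≤ Real.exp g₁ * Real.exp g₂ := by
      rw [← Real.exp_add]
      exact Real.exp_le_exp.mpr h
    have ha := Real.exp_pos g₁
    have hd := Real.exp_pos g₁₂
    have hs := Real.mul_self_sqrt (sub_nonneg.mpr hle)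
    set s := Real.sqrt (Real.exp g₁ * Real.exp g₂ - Real.exp g₁₂) with hsdef
    have hsymm : (!![Real.exp g₁, s; s, Real.exp g₂]).IsSymm := by
      ext i j
      fin_cases i <;> fin_cases j <;> rfl
    refine ⟨!![Real.exp g₁, s; s, Real.exp g₂], hsymm, ?_, ?_, ?_, ?_⟩
    · refine Matrix.PosDef.of_dotProduct_mulVec_pos ?_ ?_
      · rw [Matrix.IsHermitian, Matrix.conjTranspose_eq_transpose_of_trivial]
        exact hsymm
      · intro x hx
        have key : star x ⬝ᵥ (!![Real.exp g₁, s; s, Real.exp g₂] *ᵥ x)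
            = Real.exp g₁ * x 0 ^ 2 + 2 * s * x 0 * x 1 + Real.exp g₂ * x 1 ^ 2 := by
          simp [Matrix.mulVec, dotProduct, Fin.sum_univ_two]
          ring
        rw [key]
        refine pos_of_mul_pos_right (a := Real.exp g₁) ?_ ha.le
        have e : Real.exp g₁ *
            (Real.exp g₁ * x 0 ^ 2 + 2 * s * x 0 * x 1 + Real.exp g₂ * x 1 ^ 2)
            = (Real.exp g₁ * x 0 + s * x 1) ^ 2 + Real.exp g₁₂ * x 1 ^ 2 := by
          linear_combination (-(x 1) ^ 2) * hs
        rw [e]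
        by_cases h1 : x 1 = 0
        · have h0 : x 0 ≠ 0 := by
            intro h0
            apply hx
            ext i
            fin_cases i
            · exact h0
            · exact h1
          rw [h1]
          simp only [mul_zero, add_zero]
          positivity
        · positivity
    · simp
    · simp
    · rw [Matrix.det_fin_two_of, hs, sub_sub_cancel, Real.log_exp]
  · rintro ⟨R, hsymm, hpos, rfl, rfl, rfl⟩
    have h0 : 0 < R 0 0 := hpos.diag_pos
    have h1 : 0 < R 1 1 := hpos.diag_pos
    rw [← Real.log_mul h0.ne' h1.ne']
    apply Real.log_le_log hpos.det_pos
    rw [Matrix.det_fin_two, hsymm.apply 0 1]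
    nlinarith [mul_self_nonneg (R 0 1)]
end

section
/- (Vector-valued versus scalar Gaussians, n = 3) Let G₃ᵛ be the set of all functions g from the nonempty subsets of {1,2,3} to ℝ for which there exist a positive integer T and a symmetric positive definite real matrix R indexed by {1,2,3}×{1,…,T} such that g(s) = (1/T)·log det R_s for every nonempty s ⊆ {1,2,3}, where R_s keeps all rows and columns (i,t) with i ∈ s. Let G₃ˢ be the subset obtained by taking T = 1 (i.e., g(s) = log det R_s for a symmetric positive definite 3×3 real matrix R). Then the topological closure of G₃ᵛ equals the topological closure of the convex hull of G₃ˢ. -/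
open Matrix

theorem aux_det_one_add {n : Type*} [Fintype n] [DecidableEq n] {N : Matrix n n ℝ}
    (hN : N.PosSemidef) : 1 ≤ (1 + N).det := by
  have h1 := hN.1.spectral_theorem
  set U := hN.1.eigenvectorUnitary
  have hU : (U : Matrix n n ℝ) * star (U : Matrix n n ℝ) = 1 := Unitary.coe_mul_star_self U
  have hd : (1 + N).det = ∏ i, (1 + hN.1.eigenvalues i) := by
    have : 1 + N = (U : Matrix n n ℝ) * diagonal (fun i => 1 + hN.1.eigenvalues i) *
        star (U : Matrix n n ℝ) := by
      have e : diagonal (fun i => 1 + hN.1.eigenvalues i) =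
        1 + diagonal (RCLike.ofReal ∘ hN.1.eigenvalues : n → ℝ) := by
        rw [← diagonal_one, diagonal_add]; rfl
      rw [e, Matrix.mul_add, Matrix.add_mul, Matrix.mul_one, hU]
      congr 1
    rw [this, det_mul, det_mul, mul_right_comm, ← det_mul, hU]
    simp
  rw [hd]
  refine Finset.prod_induction (fun i => 1 + hN.1.eigenvalues i) (fun x : ℝ => 1 ≤ x)
    (fun a b ha hb => one_le_mul_of_one_le_of_one_le ha hb) le_rfl
    (fun i _ => ?_)
  have := hN.eigenvalues_nonneg i
  linarith

theorem aux_det_mono {n : Type*} [Fintype n] [DecidableEq n] {A B : Matrix n n ℝ}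
    (hA : A.PosDef) (hB : B.PosSemidef) : A.det ≤ (A + B).det := by
  obtain ⟨V, rfl⟩ : ∃ V : Matrix n n ℝ, B = Vᴴ * V := by
    open scoped MatrixOrder in
    exact CStarAlgebra.nonneg_iff_eq_star_mul_self.mp hB.nonneg
  have hu : IsUnit A.det := (Matrix.isUnit_iff_isUnit_det _).mp hA.isUnit
  have e : A + Vᴴ * V = A * (1 + (A⁻¹ * Vᴴ) * V) := by
    rw [Matrix.mul_add, Matrix.mul_one, ← Matrix.mul_assoc, ← Matrix.mul_assoc,
      Matrix.mul_nonsing_inv _ hu, Matrix.one_mul]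
  rw [e, det_mul, det_one_add_mul_comm, ← Matrix.mul_assoc]
  have := aux_det_one_add (hA.inv.posSemidef.mul_mul_conjTranspose_same V)
  nlinarith [hA.det_pos]

theorem aux_schur {m n : Type*} [Fintype m] [DecidableEq m] [Fintype n] [DecidableEq n]
    {A : Matrix m m ℝ} {B : Matrix m n ℝ} {D : Matrix n n ℝ}
    (hM : (fromBlocks A B Bᴴ D).PosDef) :
    A.PosDef ∧ (D - Bᴴ * A⁻¹ * B).PosDef ∧
      (fromBlocks A B Bᴴ D).det = A.det * (D - Bᴴ * A⁻¹ * B).det := by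
  have hA : A.PosDef := hM.submatrix (e := Sum.inl) Sum.inl_injective
  let _ := hA.isUnit.invertible
  have hd := det_fromBlocks₁₁ A B Bᴴ D
  rw [Matrix.invOf_eq_nonsing_inv] at hd
  have hS := (PosDef.fromBlocks₁₁ B D hA).mp hM.posSemidef
  refine ⟨hA, hS.posDef_iff_det_ne_zero.mpr ?_, hd⟩
  intro h0
  have := hM.det_pos
  rw [hd, h0] at this
  simp at this

theorem aux_fischer {m n : Type*} [Fintype m] [DecidableEq m] [Fintype n] [DecidableEq n]
    {M : Matrix (m ⊕ n) (m ⊕ n) ℝ} (hM : M.PosDef) :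
    M.det ≤ (M.submatrix Sum.inl Sum.inl).det * (M.submatrix Sum.inr Sum.inr).det := by
  set A := M.submatrix Sum.inl Sum.inl with hA
  set D := M.submatrix Sum.inr Sum.inr with hD
  set B := M.submatrix Sum.inl Sum.inr with hB
  have e : M = fromBlocks A B Bᴴ D := by
    ext (i|i) (j|j)
    · rfl
    · rfl
    · exact (hM.1.apply _ _).symm
    · rfl
  obtain ⟨h1, h2, h3⟩ := aux_schur (e ▸ hM)
  rw [e, h3]
  refine mul_le_mul_of_nonneg_left ?_ h1.det_pos.le
  have := aux_det_mono h2 (h1.inv.posSemidef.conjTranspose_mul_mul_same B)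
  simpa using this

theorem aux_kot {a b c : Type} [Fintype a] [DecidableEq a] [Fintype b] [DecidableEq b]
    [Fintype c] [DecidableEq c]
    {M : Matrix (a ⊕ (b ⊕ c)) (a ⊕ (b ⊕ c)) ℝ} (hM : M.PosDef) :
    M.det * (M.submatrix Sum.inl Sum.inl).det ≤
      (M.submatrix (Sum.map id Sum.inl) (Sum.map id Sum.inl)).det *
      (M.submatrix (Sum.map id Sum.inr) (Sum.map id Sum.inr)).det := by
  set A := M.submatrix Sum.inl Sum.inl with hA
  set D := M.submatrix Sum.inr Sum.inr with hD
  set B := M.submatrix Sum.inl Sum.inr with hB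
  have e : M = fromBlocks A B Bᴴ D := by
    ext (i|i) (j|j)
    · rfl
    · rfl
    · exact (hM.1.apply _ _).symm
    · rfl
  obtain ⟨h1, h2, h3⟩ := aux_schur (e ▸ hM)
  have key : ∀ {d : Type} [Fintype d] [DecidableEq d] (f : d → b ⊕ c),
      Function.Injective f →
      (M.submatrix (Sum.map id f) (Sum.map id f)).det =
        A.det * ((D - Bᴴ * A⁻¹ * B).submatrix f f).det := by
    intro d _ _ f hf
    have e2 : M.submatrix (Sum.map id f) (Sum.map id f) =
      fromBlocks A (B.submatrix id f) (B.submatrix id f)ᴴ (D.submatrix f f) := by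
      ext (i|i) (j|j)
      · rfl
      · rfl
      · exact (hM.1.apply _ _).symm
      · rfl
    have hp : (M.submatrix (Sum.map id f) (Sum.map id f)).PosDef :=
      hM.submatrix (Function.injective_id.sumMap hf)
    obtain ⟨-, -, h⟩ := aux_schur (e2 ▸ hp)
    rw [e2, h]
    rfl
  have k1 := key (Sum.inl : b → b ⊕ c) Sum.inl_injective
  have k2 := key (Sum.inr : c → b ⊕ c) Sum.inr_injective
  rw [k1, k2]
  have h3' : M.det = A.det * (D - Bᴴ * A⁻¹ * B).det := by rw [← h3, ← e]
  rw [h3']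
  have hf := aux_fischer h2
  have hp := h1.det_pos
  calc _ = A.det * A.det * (D - Bᴴ * A⁻¹ * B).det := by ring
    _ ≤ A.det * A.det * _ := mul_le_mul_of_nonneg_left hf (by positivity)
    _ = _ := by ring

theorem aux_det_sub {ι κ : Type*} [Fintype κ] [DecidableEq κ] (p : ι → Prop)
    [Fintype {x // p x}] [DecidableEq {x // p x}] (M : Matrix ι ι ℝ) (e : κ → ι)
    (he : Function.Injective e) (hp : ∀ x, p x ↔ x ∈ Set.range e) :
    (M.submatrix (fun x : {x // p x} => (x : ι)) (fun x : {x // p x} => (x : ι))).det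
      = (M.submatrix e e).det := by
  let E : κ ≃ {x // p x} := Equiv.ofBijective (fun k => ⟨e k, (hp _).2 ⟨k, rfl⟩⟩)
    ⟨fun a b h => he (congrArg Subtype.val h), fun ⟨x, hx⟩ => by
      obtain ⟨k, rfl⟩ := (hp x).1 hx
      exact ⟨k, rfl⟩⟩
  rw [← det_submatrix_equiv_self E]
  rfl

/-- Nonempty subsets of a three element set. -/
abbrev AuxIdx := {s : Finset (Fin 3) // s.Nonempty}

/-- Principal minor of a `3 × 3` matrix. -/
noncomputable def auxPm (R : Matrix (Fin 3) (Fin 3) ℝ) (s : AuxIdx) : ℝ :=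
  (R.submatrix (fun i : {x // x ∈ s.1} => (i : Fin 3))
    (fun i : {x // x ∈ s.1} => (i : Fin 3))).det

def auxS1 (i : Fin 3) : AuxIdx := ⟨{i}, by simp⟩
def auxS2 (i j : Fin 3) : AuxIdx := ⟨{i, j}, by simp⟩
def auxS3 : AuxIdx := ⟨Finset.univ, by simp⟩

theorem aux_forall {Q : AuxIdx → Prop} (h0 : Q (auxS1 0)) (h1 : Q (auxS1 1)) (h2 : Q (auxS1 2))
    (h01 : Q (auxS2 0 1)) (h02 : Q (auxS2 0 2)) (h12 : Q (auxS2 1 2)) (h3 : Q auxS3) :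
    ∀ s, Q s := by
  have key : ∀ s : AuxIdx, s = auxS1 0 ∨ s = auxS1 1 ∨ s = auxS1 2 ∨ s = auxS2 0 1 ∨
      s = auxS2 0 2 ∨ s = auxS2 1 2 ∨ s = auxS3 := by
    decide
  intro s
  rcases key s with h | h | h | h | h | h | h <;> rw [h] <;> assumption

theorem auxPm_s1 (R : Matrix (Fin 3) (Fin 3) ℝ) (i : Fin 3) : auxPm R (auxS1 i) = R i i := by
  unfold auxPm auxS1
  rw [aux_det_sub (fun x => x ∈ ({i} : Finset (Fin 3))) R (fun _ : Fin 1 => i)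
    (fun a b _ => Subsingleton.elim _ _) (by intro x; simp [eq_comm])]
  simp

theorem auxPm_s2 (R : Matrix (Fin 3) (Fin 3) ℝ) {i j : Fin 3} (h : i ≠ j) :
    auxPm R (auxS2 i j) = R i i * R j j - R i j * R j i := by
  unfold auxPm auxS2
  rw [aux_det_sub (fun x => x ∈ ({i, j} : Finset (Fin 3))) R ![i, j]
    (by intro a b; fin_cases a <;> fin_cases b <;> simp [h, h.symm])
    (by intro x; simp [eq_comm, or_comm])]
  rw [det_fin_two]
  simp

theorem auxPm_s3 (R : Matrix (Fin 3) (Fin 3) ℝ) : auxPm R auxS3 = R.det := by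
  unfold auxPm auxS3
  rw [aux_det_sub (fun x => x ∈ (Finset.univ : Finset (Fin 3))) R id
    Function.injective_id (by intro x; simp)]
  simp

theorem auxPm_pos {R : Matrix (Fin 3) (Fin 3) ℝ} (hR : R.PosDef) (s : AuxIdx) :
    0 < auxPm R s :=
  (hR.submatrix Subtype.val_injective).det_pos

theorem auxPm_one (s : AuxIdx) : auxPm 1 s = 1 := by
  unfold auxPm
  rw [submatrix_one _ Subtype.val_injective, det_one]

/-- Vector-valued region. -/
def auxGv : Set (AuxIdx → ℝ) :=
  {g | ∃ T : ℕ, 0 < T ∧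
        ∃ R : Matrix (Fin 3 × Fin T) (Fin 3 × Fin T) ℝ, R.IsSymm ∧ R.PosDef ∧
          ∀ s : {s : Finset (Fin 3) // s.Nonempty},
            g s = (1 / (T : ℝ)) * Real.log
              (R.submatrix
                (fun p : {p : Fin 3 × Fin T // p.1 ∈ s.1} => (p : Fin 3 × Fin T))
                (fun p : {p : Fin 3 × Fin T // p.1 ∈ s.1} => (p : Fin 3 × Fin T))).det}

/-- Scalar region. -/
def auxGs : Set (AuxIdx → ℝ) :=
  {g | ∃ R : Matrix (Fin 3) (Fin 3) ℝ, R.IsSymm ∧ R.PosDef ∧ ∀ s, g s = Real.log (auxPm R s)}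

/-- Uniform averages of points of the scalar region. -/
def auxA : Set (AuxIdx → ℝ) :=
  {g | ∃ n : ℕ, 0 < n ∧ ∃ R : Fin n → Matrix (Fin 3) (Fin 3) ℝ, (∀ t, (R t).PosDef) ∧
    ∀ s, g s = (1 / (n : ℝ)) * ∑ t, Real.log (auxPm (R t) s)}

/-- The submodular cone. -/
def auxP : Set (AuxIdx → ℝ) :=
  {g | ∀ i j k : Fin 3, i ≠ j → i ≠ k → j ≠ k →
    g (auxS2 i j) ≤ g (auxS1 i) + g (auxS1 j) ∧
    g auxS3 + g (auxS1 i) ≤ g (auxS2 i j) + g (auxS2 i k)}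

theorem aux_symm {n : Type*} {R : Matrix n n ℝ} (hR : R.PosDef) : R.IsSymm := by
  have := hR.1
  rwa [Matrix.IsHermitian, conjTranspose_eq_transpose_of_trivial] at this

theorem auxP_convex : Convex ℝ auxP := by
  intro x hx y hy a b ha hb _ i j k h1 h2 h3
  obtain ⟨p, q⟩ := hx i j k h1 h2 h3
  obtain ⟨p', q'⟩ := hy i j k h1 h2 h3
  simp only [Pi.add_apply, Pi.smul_apply, smul_eq_mul]
  constructor
  · nlinarith [mul_le_mul_of_nonneg_left p ha, mul_le_mul_of_nonneg_left p' hb]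
  · nlinarith [mul_le_mul_of_nonneg_left q ha, mul_le_mul_of_nonneg_left q' hb]

theorem auxGv_sub_P : auxGv ⊆ auxP := by
  rintro g ⟨T, hT, R, -, hR, hg⟩ i j k hij hik hjk
  have hT' : (0 : ℝ) < 1 / T := by positivity
  have i1 : ∀ i : Fin 3, Function.Injective (fun t : Fin T => (i, t)) := by
    intro i a b h; simpa using h
  have i2 : ∀ {i j : Fin 3}, i ≠ j → Function.Injective
      (Sum.elim (fun t : Fin T => (i, t)) (fun t : Fin T => (j, t))) := by
    intro i j h
    rintro (a|a) (b|b) hab <;> simp_all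
  have i3 : Function.Injective (Sum.elim (fun t : Fin T => (i, t))
      (Sum.elim (fun t : Fin T => (j, t)) (fun t : Fin T => (k, t)))) := by
    rintro (a|a|a) (b|b|b) hab <;> simp_all
  have d1 : ∀ i, g (auxS1 i) = (1 / (T : ℝ)) * Real.log (R.submatrix (fun t : Fin T => (i, t))
      (fun t : Fin T => (i, t))).det := by
    intro i
    rw [hg]
    congr 2
    exact aux_det_sub (fun p : Fin 3 × Fin T => p.1 ∈ (auxS1 i).1) R _ (i1 i)
      (by rintro ⟨x, t⟩; simp [auxS1, eq_comm])
  have d2 : ∀ {i j}, i ≠ j → g (auxS2 i j) = (1 / (T : ℝ)) * Real.log (R.submatrix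
      (Sum.elim (fun t : Fin T => (i, t)) (fun t : Fin T => (j, t)))
      (Sum.elim (fun t : Fin T => (i, t)) (fun t : Fin T => (j, t)))).det := by
    intro i j h
    rw [hg]
    congr 2
    exact aux_det_sub (fun p : Fin 3 × Fin T => p.1 ∈ (auxS2 i j).1) R _ (i2 h)
      (by rintro ⟨x, t⟩; simp [auxS2, eq_comm])
  have hall : ∀ x : Fin 3, x = i ∨ x = j ∨ x = k := by
    clear d1 d2 i1 i2 i3 hg
    revert i j k
    decide
  have d3 : g auxS3 = (1 / (T : ℝ)) * Real.log (R.submatrix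
      (Sum.elim (fun t : Fin T => (i, t))
        (Sum.elim (fun t : Fin T => (j, t)) (fun t : Fin T => (k, t))))
      (Sum.elim (fun t : Fin T => (i, t))
        (Sum.elim (fun t : Fin T => (j, t)) (fun t : Fin T => (k, t))))).det := by
    rw [hg]
    congr 2
    refine aux_det_sub (fun p : Fin 3 × Fin T => p.1 ∈ auxS3.1) R _ i3 ?_
    rintro ⟨x, t⟩
    have := hall x
    simp [auxS3, eq_comm] at this ⊢
    tauto
  have p1 := fun i => (hR.submatrix (i1 i)).det_pos
  have p2 := fun {i j} (h : i ≠ j) => (hR.submatrix (i2 h)).det_pos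
  have p3 := (hR.submatrix i3).det_pos
  constructor
  · rw [d1, d1, d2 hij, ← mul_add, ← Real.log_mul (p1 _).ne' (p1 _).ne']
    exact mul_le_mul_of_nonneg_left
      (Real.log_le_log (p2 hij) (aux_fischer (hR.submatrix (i2 hij)))) hT'.le
  · rw [d1, d3, d2 hij, d2 hik, ← mul_add, ← mul_add, ← Real.log_mul p3.ne' (p1 _).ne',
      ← Real.log_mul (p2 hij).ne' (p2 hik).ne']
    refine mul_le_mul_of_nonneg_left
      (Real.log_le_log (mul_pos p3 (p1 _)) ?_) hT'.le
    have := aux_kot (hR.submatrix i3)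
    simp only [submatrix_submatrix] at this
    convert this using 3 <;>
    · congr 1 <;> · ext (a|a) <;> rfl

theorem auxA_sub_conv : auxA ⊆ convexHull ℝ auxGs := by
  rintro g ⟨n, hn, R, hR, hg⟩
  have : g = ∑ t : Fin n, (1 / (n : ℝ)) • (fun s => Real.log (auxPm (R t) s)) := by
    ext s
    rw [hg, Finset.sum_apply, Finset.mul_sum]
    rfl
  rw [this]
  refine (convex_convexHull ℝ auxGs).sum_mem (fun _ _ => by positivity) ?_ ?_
  · have : (n : ℝ) ≠ 0 := by positivity
    simp [this]
  · intro t _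
    exact subset_convexHull ℝ _ ⟨R t, aux_symm (hR t), hR t, fun _ => rfl⟩

theorem auxGs_sub_A : auxGs ⊆ auxA := by
  rintro g ⟨R, -, hR, hg⟩
  exact ⟨1, one_pos, fun _ => R, fun _ => hR, fun s => by simp [hg]⟩

theorem aux_blockDiagonal {n : ℕ} {R : Fin n → Matrix (Fin 3) (Fin 3) ℝ}
    (hR : ∀ t, (R t).PosDef) : (blockDiagonal R).PosDef := by
  refine PosDef.of_dotProduct_mulVec_pos ?_ ?_
  · rw [Matrix.IsHermitian, blockDiagonal_conjTranspose]
    congr 1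
    ext1 t
    exact (hR t).1
  · intro x hx
    have e : star x ⬝ᵥ (blockDiagonal R *ᵥ x) =
        ∑ t, star (fun i => x (i, t)) ⬝ᵥ (R t *ᵥ fun i => x (i, t)) := by
      simp only [dotProduct, mulVec, Fintype.sum_prod_type_right, blockDiagonal_apply]
      simp
    rw [e]
    obtain ⟨⟨i, t⟩, hit⟩ := Function.ne_iff.mp hx
    refine Finset.sum_pos' (fun t _ => (hR t).posSemidef.dotProduct_mulVec_nonneg _)
      ⟨t, Finset.mem_univ _, (hR t).dotProduct_mulVec_pos ?_⟩
    intro h0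
    exact hit (congrFun h0 i)

theorem auxA_sub_Gv : auxA ⊆ auxGv := by
  rintro g ⟨n, hn, R, hR, hg⟩
  have hB := aux_blockDiagonal hR
  refine ⟨n, hn, blockDiagonal R, aux_symm hB, hB, fun s => ?_⟩
  rw [hg]
  congr 1
  rw [← Real.log_prod (fun t _ => (auxPm_pos (hR t) s).ne')]
  congr 1
  rw [aux_det_sub (fun p : Fin 3 × Fin n => p.1 ∈ s.1) (blockDiagonal R)
    (fun q : {x // x ∈ s.1} × Fin n => ((q.1 : Fin 3), q.2))]
  · unfold auxPm
    rw [← det_blockDiagonal]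
    congr 1
  · rintro ⟨a, t⟩ ⟨b, u⟩ h
    have h1 := congrArg Prod.fst h
    have h2 := congrArg Prod.snd h
    exact Prod.ext (Subtype.ext h1) h2
  · rintro ⟨x, t⟩
    simp

theorem auxA_fintype {κ : Type} [Fintype κ] [Nonempty κ] (R : κ → Matrix (Fin 3) (Fin 3) ℝ)
    (hR : ∀ t, (R t).PosDef) :
    (fun s => (1 / (Fintype.card κ : ℝ)) * ∑ t, Real.log (auxPm (R t) s)) ∈ auxA := by
  refine ⟨Fintype.card κ, Fintype.card_pos, fun i => R ((Fintype.equivFin κ).symm i),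
    fun t => hR _, fun s => ?_⟩
  dsimp only
  congr 1
  exact (Equiv.sum_comp (Fintype.equivFin κ).symm (fun t => Real.log (auxPm (R t) s))).symm

theorem auxA_mid {x y : AuxIdx → ℝ} (hx : x ∈ auxA) (hy : y ∈ auxA) :
    (1 / 2 : ℝ) • (x + y) ∈ auxA := by
  obtain ⟨n, hn, R, hR, hg⟩ := hx
  obtain ⟨m, hm, S, hS, hk⟩ := hy
  have : Nonempty (Fin n) := ⟨⟨0, hn⟩⟩
  have : Nonempty (Fin m) := ⟨⟨0, hm⟩⟩
  have := auxA_fintype (κ := (Fin n × Fin m) ⊕ (Fin n × Fin m))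
    (Sum.elim (fun p => R p.1) (fun p => S p.2)) (by rintro (t|t) <;> simp [hR, hS])
  convert this using 1
  ext s
  have h1 : (n : ℝ) ≠ 0 := by positivity
  have h2 : (m : ℝ) ≠ 0 := by positivity
  simp only [Pi.smul_apply, Pi.add_apply, hg, hk, smul_eq_mul, Fintype.sum_sum_type, Sum.elim_inl,
    Sum.elim_inr, Fintype.sum_prod_type, Finset.sum_const, Finset.card_univ, Fintype.card_fin,
    nsmul_eq_mul, Fintype.card_sum, Fintype.card_prod, ← Finset.mul_sum]
  push_cast
  field_simp
  ring

/-- Directions all of whose nonnegative multiples are in the closure of `auxA`. -/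
def auxC : Set (AuxIdx → ℝ) := {d | ∀ t : ℝ, 0 ≤ t → t • d ∈ closure auxA}

theorem auxC_add {x y : AuxIdx → ℝ} (hx : x ∈ auxC) (hy : y ∈ auxC) : x + y ∈ auxC := by
  intro t ht
  have h := map_mem_closure₂ (f := fun a b : AuxIdx → ℝ => (1 / 2 : ℝ) • (a + b))
    (by fun_prop) (hx (2 * t) (by linarith)) (hy (2 * t) (by linarith))
    (fun a ha b hb => auxA_mid ha hb)
  convert h using 1
  ext s
  simp
  ring

theorem auxC_smul {x : AuxIdx → ℝ} (hx : x ∈ auxC) {r : ℝ} (hr : 0 ≤ r) : r • x ∈ auxC := by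
  intro t ht
  rw [smul_smul]
  exact hx _ (mul_nonneg ht hr)

theorem auxA_scale {R : Matrix (Fin 3) (Fin 3) ℝ} (hR : R.PosDef) (n : ℕ) :
    (fun s => (1 / ((n : ℝ) + 1)) * Real.log (auxPm R s)) ∈ auxA := by
  refine ⟨n + 1, n.succ_pos, fun i => if i = 0 then R else 1, ?_, fun s => ?_⟩
  · intro t
    dsimp only
    split_ifs
    · exact hR
    · exact PosDef.one
  · push_cast
    congr 1
    rw [Finset.sum_eq_single 0]
    · simp
    · intro b _ hb
      simp [hb, auxPm_one]
    · simp

theorem auxC_ray (V : Matrix (Fin 3) (Fin 3) ℝ) (k : AuxIdx → ℕ)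
    (h : ∀ s, ∀ ε : ℝ, 0 < ε → ε ≤ 1 → ε ^ k s ≤ auxPm (ε • 1 + Vᴴ * V) s ∧
      auxPm (ε • 1 + Vᴴ * V) s ≤ 64 * ε ^ k s) :
    (fun s => -(k s : ℝ)) ∈ auxC := by
  intro t ht
  have hpd : ∀ ε : ℝ, 0 < ε → (ε • (1 : Matrix (Fin 3) (Fin 3) ℝ) + Vᴴ * V).PosDef := fun ε hε =>
    (PosDef.one.smul hε).add_posSemidef (posSemidef_conjTranspose_mul_self V)
  let ε : ℕ → ℝ := fun n => Real.exp (-((n + 1) * t))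
  refine mem_closure_of_tendsto (b := Filter.atTop) (f := fun (n : ℕ) s =>
    (1 / ((n : ℝ) + 1)) * Real.log (auxPm (ε n • 1 + Vᴴ * V) s)) ?_
    (Filter.Eventually.of_forall fun n => auxA_scale (hpd _ (Real.exp_pos _)) n)
  rw [tendsto_pi_nhds]
  intro s
  have lim : Filter.Tendsto (fun n : ℕ => -(k s : ℝ) * t + Real.log 64 * (1 / ((n : ℝ) + 1)))
      Filter.atTop (nhds (-(k s : ℝ) * t + Real.log 64 * 0)) :=
    (tendsto_one_div_add_atTop_nhds_zero_nat.const_mul _).const_add _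
  have e : (t • fun s => -(k s : ℝ)) s = -(k s : ℝ) * t := by simp [mul_comm]
  rw [e]
  rw [mul_zero, add_zero] at lim
  refine tendsto_of_tendsto_of_tendsto_of_le_of_le tendsto_const_nhds lim ?_ ?_
  all_goals
    intro n
    have hn : (0 : ℝ) < (n : ℝ) + 1 := by positivity
    have hε : 0 < ε n := Real.exp_pos _
    obtain ⟨l, u⟩ := h s (ε n) hε (Real.exp_le_one_iff.mpr (by
      have : 0 ≤ ((n : ℝ) + 1) * t := by positivity
      linarith))
    have hlog : Real.log (ε n ^ k s) = -(k s : ℝ) * t * (n + 1) := by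
      rw [Real.log_pow, Real.log_exp]; ring
    have l' := Real.log_le_log (by positivity) l
    have u' := Real.log_le_log (auxPm_pos (hpd _ hε) s) u
    rw [Real.log_mul (by norm_num) (by positivity), hlog] at u'
    rw [hlog] at l'
    dsimp only
  · rw [one_div, inv_mul_eq_div, le_div_iff₀ hn]
    exact l'
  · rw [one_div, inv_mul_eq_div, div_le_iff₀ hn]
    refine u'.trans (le_of_eq ?_)
    field_simp
    ring

theorem auxC_diag (a : Fin 3 → ℝ) : (fun s : AuxIdx => ∑ i ∈ s.1, a i) ∈ auxC := by
  intro t _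
  apply subset_closure
  apply auxGs_sub_A
  have hp : (diagonal fun i => Real.exp (t * a i)).PosDef := PosDef.diagonal fun i => Real.exp_pos _
  refine ⟨_, aux_symm hp, hp, ?_⟩
  have h01 : (0 : Fin 3) ≠ 1 := by decide
  have h02 : (0 : Fin 3) ≠ 2 := by decide
  have h12 : (1 : Fin 3) ≠ 2 := by decide
  apply aux_forall
  · rw [auxPm_s1]; simp [auxS1]
  · rw [auxPm_s1]; simp [auxS1]
  · rw [auxPm_s1]; simp [auxS1]
  · rw [auxPm_s2 _ h01]; simp [auxS2, ← Real.exp_add]; ring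
  · rw [auxPm_s2 _ h02]; simp [auxS2, ← Real.exp_add]; ring
  · rw [auxPm_s2 _ h12]; simp [auxS2, ← Real.exp_add]; ring
  · rw [auxPm_s3]; simp [auxS3, Fin.prod_univ_three, Fin.sum_univ_three, ← Real.exp_add]; ring

/-- Build a function on nonempty subsets by listing it on pairs and the whole set. -/
def auxK (p q r w : ℕ) (s : AuxIdx) : ℕ :=
  if s = auxS2 0 1 then p else if s = auxS2 0 2 then q else if s = auxS2 1 2 then r
  else if s = auxS3 then w else 0

theorem auxK_s1 (p q r w : ℕ) (i : Fin 3) : auxK p q r w (auxS1 i) = 0 := by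
  have : auxS1 i ≠ auxS2 0 1 ∧ auxS1 i ≠ auxS2 0 2 ∧ auxS1 i ≠ auxS2 1 2 ∧ auxS1 i ≠ auxS3 := by
    revert i; decide
  simp [auxK, this]

theorem auxK_01 (p q r w : ℕ) : auxK p q r w (auxS2 0 1) = p := by simp [auxK]

theorem auxK_02 (p q r w : ℕ) : auxK p q r w (auxS2 0 2) = q := by
  have : auxS2 0 2 ≠ auxS2 0 1 := by decide
  simp [auxK, this]

theorem auxK_12 (p q r w : ℕ) : auxK p q r w (auxS2 1 2) = r := by
  have : auxS2 1 2 ≠ auxS2 0 1 ∧ auxS2 1 2 ≠ auxS2 0 2 := by decide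
  simp [auxK, this]

theorem auxK_3 (p q r w : ℕ) : auxK p q r w auxS3 = w := by
  have : auxS3 ≠ auxS2 0 1 ∧ auxS3 ≠ auxS2 0 2 ∧ auxS3 ≠ auxS2 1 2 := by decide
  simp [auxK, this]

theorem auxC_rays (V : Matrix (Fin 3) (Fin 3) ℝ) (p q r w : ℕ)
    (h : ∀ R : Matrix (Fin 3) (Fin 3) ℝ, ∀ ε : ℝ, 0 < ε → ε ≤ 1 → R = ε • 1 + Vᴴ * V →
      (∀ i, 1 ≤ R i i ∧ R i i ≤ 64) ∧
      (ε ^ p ≤ R 0 0 * R 1 1 - R 0 1 * R 1 0 ∧ R 0 0 * R 1 1 - R 0 1 * R 1 0 ≤ 64 * ε ^ p) ∧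
      (ε ^ q ≤ R 0 0 * R 2 2 - R 0 2 * R 2 0 ∧ R 0 0 * R 2 2 - R 0 2 * R 2 0 ≤ 64 * ε ^ q) ∧
      (ε ^ r ≤ R 1 1 * R 2 2 - R 1 2 * R 2 1 ∧ R 1 1 * R 2 2 - R 1 2 * R 2 1 ≤ 64 * ε ^ r) ∧
      (ε ^ w ≤ R.det ∧ R.det ≤ 64 * ε ^ w)) :
    (fun s => -(auxK p q r w s : ℝ)) ∈ auxC := by
  apply auxC_ray V
  have h01 : (0 : Fin 3) ≠ 1 := by decide
  have h02 : (0 : Fin 3) ≠ 2 := by decide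
  have h12 : (1 : Fin 3) ≠ 2 := by decide
  apply aux_forall <;> intro ε h0 h1 <;> obtain ⟨a, b, c, d, e⟩ := h _ ε h0 h1 rfl
  · rw [auxPm_s1, auxK_s1]; simpa using a 0
  · rw [auxPm_s1, auxK_s1]; simpa using a 1
  · rw [auxPm_s1, auxK_s1]; simpa using a 2
  · rw [auxPm_s2 _ h01, auxK_01]; exact b
  · rw [auxPm_s2 _ h02, auxK_02]; exact c
  · rw [auxPm_s2 _ h12, auxK_12]; exact d
  · rw [auxPm_s3, auxK_3]; exact e

theorem auxC_all : (fun s => -(auxK 1 1 1 2 s : ℝ)) ∈ auxC := by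
  apply auxC_rays !![1, 1, 1; 0, 0, 0; 0, 0, 0]
  intro R ε h0 h1 hR
  have : R = !![1 + ε, 1, 1; 1, 1 + ε, 1; 1, 1, 1 + ε] := by
    rw [hR]; ext i j
    fin_cases i <;> fin_cases j <;> simp [Matrix.mul_apply, Fin.sum_univ_three, add_comm]
  subst this
  simp only [det_fin_three, Fin.forall_fin_succ]
  simp
  refine ⟨?_, ?_, ?_⟩ <;> constructor <;> 
    nlinarith [mul_pos h0 h0, mul_pos (mul_pos h0 h0) h0,
    mul_nonneg (mul_pos h0 h0).le (sub_nonneg.2 h1), mul_nonneg h0.le (sub_nonneg.2 h1)]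

theorem auxC_w : (fun s => -(auxK 0 0 0 1 s : ℝ)) ∈ auxC := by
  apply auxC_rays !![1, 0, 1; 0, 1, 1; 0, 0, 0]
  intro R ε h0 h1 hR
  have : R = !![1 + ε, 0, 1; 0, 1 + ε, 1; 1, 1, 2 + ε] := by
    rw [hR]; ext i j
    fin_cases i <;> fin_cases j <;> simp [Matrix.mul_apply, Fin.sum_univ_three, add_comm]
    ring
  subst this
  simp only [det_fin_three, Fin.forall_fin_succ]
  simp
  constructorm* _ ∧ _ <;>
    nlinarith [mul_pos h0 h0, mul_pos (mul_pos h0 h0) h0,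
    mul_nonneg (mul_pos h0 h0).le (sub_nonneg.2 h1), mul_nonneg h0.le (sub_nonneg.2 h1)]

theorem auxC_01 : (fun s => -(auxK 1 0 0 1 s : ℝ)) ∈ auxC := by
  apply auxC_rays !![1, 1, 0; 0, 0, 1; 0, 0, 0]
  intro R ε h0 h1 hR
  have : R = !![1 + ε, 1, 0; 1, 1 + ε, 0; 0, 0, 1 + ε] := by
    rw [hR]; ext i j
    fin_cases i <;> fin_cases j <;> simp [Matrix.mul_apply, Fin.sum_univ_three, add_comm]
  subst this
  simp only [det_fin_three, Fin.forall_fin_succ]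
  simp
  constructorm* _ ∧ _ <;>
    nlinarith [mul_pos h0 h0, mul_pos (mul_pos h0 h0) h0,
    mul_nonneg (mul_pos h0 h0).le (sub_nonneg.2 h1), mul_nonneg h0.le (sub_nonneg.2 h1)]

theorem auxC_02 : (fun s => -(auxK 0 1 0 1 s : ℝ)) ∈ auxC := by
  apply auxC_rays !![1, 0, 1; 0, 1, 0; 0, 0, 0]
  intro R ε h0 h1 hR
  have : R = !![1 + ε, 0, 1; 0, 1 + ε, 0; 1, 0, 1 + ε] := by
    rw [hR]; ext i j
    fin_cases i <;> fin_cases j <;> simp [Matrix.mul_apply, Fin.sum_univ_three, add_comm]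
  subst this
  simp only [det_fin_three, Fin.forall_fin_succ]
  simp
  constructorm* _ ∧ _ <;>
    nlinarith [mul_pos h0 h0, mul_pos (mul_pos h0 h0) h0,
    mul_nonneg (mul_pos h0 h0).le (sub_nonneg.2 h1), mul_nonneg h0.le (sub_nonneg.2 h1)]

theorem auxC_12 : (fun s => -(auxK 0 0 1 1 s : ℝ)) ∈ auxC := by
  apply auxC_rays !![0, 1, 1; 1, 0, 0; 0, 0, 0]
  intro R ε h0 h1 hR
  have : R = !![1 + ε, 0, 0; 0, 1 + ε, 1; 0, 1, 1 + ε] := by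
    rw [hR]; ext i j
    fin_cases i <;> fin_cases j <;> simp [Matrix.mul_apply, Fin.sum_univ_three, add_comm]
  subst this
  simp only [det_fin_three, Fin.forall_fin_succ]
  simp
  constructorm* _ ∧ _ <;>
    nlinarith [mul_pos h0 h0, mul_pos (mul_pos h0 h0) h0,
    mul_nonneg (mul_pos h0 h0).le (sub_nonneg.2 h1), mul_nonneg h0.le (sub_nonneg.2 h1)]

theorem auxP_sub : auxP ⊆ closure auxA := by
  intro g hg
  have h01 : (0 : Fin 3) ≠ 1 := by decide
  have h02 : (0 : Fin 3) ≠ 2 := by decide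
  have h12 : (1 : Fin 3) ≠ 2 := by decide
  obtain ⟨a1, b1⟩ := hg 0 1 2 h01 h02 h12
  obtain ⟨a2, -⟩ := hg 0 2 1 h02 h01 h12.symm
  obtain ⟨a3, b3⟩ := hg 1 2 0 h12 h01.symm h02.symm
  obtain ⟨-, b2⟩ := hg 2 0 1 h02.symm h12.symm h01
  have e10 : auxS2 1 0 = auxS2 0 1 := by decide
  have e20 : auxS2 2 0 = auxS2 0 2 := by decide
  have e21 : auxS2 2 1 = auxS2 1 2 := by decide
  rw [e10] at b3
  rw [e20, e21] at b2
  obtain ⟨p, hp⟩ : ∃ p, p = g (auxS1 0) + g (auxS1 1) - g (auxS2 0 1) := ⟨_, rfl⟩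
  obtain ⟨q, hq⟩ : ∃ q, q = g (auxS1 0) + g (auxS1 2) - g (auxS2 0 2) := ⟨_, rfl⟩
  obtain ⟨r, hr⟩ : ∃ r, r = g (auxS1 1) + g (auxS1 2) - g (auxS2 1 2) := ⟨_, rfl⟩
  obtain ⟨m, m0, mp, mq, mr, hm⟩ : ∃ m, 0 ≤ m ∧ m ≤ p ∧ m ≤ q ∧ m ≤ r ∧
      (m = p ∨ m = q ∨ m = r) := by
    refine ⟨min p (min q r), ?_, by simp, by simp, by simp, ?_⟩
    · simp only [le_min_iff]
      refine ⟨?_, ?_, ?_⟩ <;> linarith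
    · rcases min_choice p (min q r) with h | h
      · exact Or.inl h
      · rw [h]; exact Or.inr (min_choice q r)
  obtain ⟨w, hw⟩ : ∃ w, w = g (auxS1 0) + g (auxS1 1) + g (auxS1 2) - g auxS3 - p - q - r + m :=
    ⟨_, rfl⟩
  have w0 : 0 ≤ w := by
    rcases hm with h | h | h <;> linarith
  have key := auxC_add (auxC_diag (fun i => g (auxS1 i)))
    (auxC_add (auxC_smul auxC_all m0) (auxC_add (auxC_smul auxC_01 (sub_nonneg.2 mp))
    (auxC_add (auxC_smul auxC_02 (sub_nonneg.2 mq)) (auxC_add (auxC_smul auxC_12 (sub_nonneg.2 mr))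
    (auxC_smul auxC_w w0)))))
  have := key 1 zero_le_one
  rw [one_smul] at this
  convert this using 1
  funext s
  revert s
  apply aux_forall <;>
    simp only [Pi.add_apply, Pi.smul_apply, auxK_s1, auxK_01, auxK_02, auxK_12, auxK_3, smul_eq_mul]
  · simp [auxS1]
  · simp [auxS1]
  · simp [auxS1]
  · rw [show (auxS2 0 1).1 = {0, 1} from rfl, Finset.sum_pair h01]; push_cast; linarith
  · rw [show (auxS2 0 2).1 = {0, 2} from rfl, Finset.sum_pair h02]; push_cast; linarith
  · rw [show (auxS2 1 2).1 = {1, 2} from rfl, Finset.sum_pair h12]; push_cast; linarith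
  · rw [show auxS3.1 = Finset.univ from rfl, Fin.sum_univ_three]; push_cast; linarith

/-- For `n = 3`, the closure of the entropy region of vector-valued jointly Gaussian random
variables equals the closure of the convex hull of the entropy region of scalar-valued
jointly Gaussian random variables. -/
theorem stmt_5 :
    closure {g : {s : Finset (Fin 3) // s.Nonempty} → ℝ |
      ∃ T : ℕ, 0 < T ∧
        ∃ R : Matrix (Fin 3 × Fin T) (Fin 3 × Fin T) ℝ, R.IsSymm ∧ R.PosDef ∧
          ∀ s : {s : Finset (Fin 3) // s.Nonempty},
            g s = (1 / (T : ℝ)) * Real.log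
              (R.submatrix
                (fun p : {p : Fin 3 × Fin T // p.1 ∈ s.1} => (p : Fin 3 × Fin T))
                (fun p : {p : Fin 3 × Fin T // p.1 ∈ s.1} => (p : Fin 3 × Fin T))).det}
    = closure (convexHull ℝ
        {g : {s : Finset (Fin 3) // s.Nonempty} → ℝ |
          ∃ R : Matrix (Fin 3) (Fin 3) ℝ, R.IsSymm ∧ R.PosDef ∧
            ∀ s : {s : Finset (Fin 3) // s.Nonempty},
              g s = Real.log
                (R.submatrix
                  (fun i : {x // x ∈ s.1} => (i : Fin 3))
                  (fun i : {x // x ∈ s.1} => (i : Fin 3))).det}) := by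
  change closure auxGv = closure (convexHull ℝ auxGs)
  have hGsP : auxGs ⊆ auxP := auxGs_sub_A.trans (auxA_sub_Gv.trans auxGv_sub_P)
  apply Set.Subset.antisymm
  · exact closure_minimal ((auxGv_sub_P.trans auxP_sub).trans (closure_mono auxA_sub_conv))
      isClosed_closure
  · exact closure_minimal (((convexHull_min hGsP auxP_convex).trans auxP_sub).trans
      (closure_mono auxA_sub_Gv)) isClosed_closure
end
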